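/- arXiv:2309.01789 — 2 statements merged into one kernel-verified Lean document; each statement's English description precedes it below -/
import Mathlib

section
/- Let p and q be coprime positive integers and let i be an integer with 0 ≤ i < p such that ⌊i/q⌋ = ⌊(i+1)/q⌋. Then for every integer t, D_{i+1,tq} − D_{i,tq} = 2t. -/
/-- The grading-shift constants `D_{i,s}` from the mapping cone formula:
`D p q i s = ∑_{k=0}^{s-1} 2⌊(i+pk)/q⌋` for `s > 0`, `0` for `s = 0`, and
`∑_{k=1}^{-s} 2⌈(kp-i)/q⌉` for `s < 0`, where floors/ceilings are of rationals. -/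
def mappingConeD (p q i s : ℤ) : ℤ :=
  if 0 < s then ∑ k ∈ Finset.range s.toNat, 2 * ⌊((i : ℚ) + (p : ℚ) * (k : ℚ)) / (q : ℚ)⌋
  else if s = 0 then 0
  else ∑ k ∈ Finset.Icc 1 (-s).toNat, 2 * ⌈((k : ℚ) * (p : ℚ) - (i : ℚ)) / (q : ℚ)⌉

theorem floor_intCast_div_intCast {q : ℤ} (hq : 0 ≤ q) (n : ℤ) :
    ⌊(n : ℚ) / (q : ℚ)⌋ = n / q := by
  lift q to ℕ using hq
  exact_mod_cast Rat.floor_intCast_div_natCast n q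

theorem succ_ediv_sub_ediv {q : ℤ} (hq : 0 < q) (n : ℤ) :
    (n + 1) / q - n / q = if q ∣ n + 1 then 1 else 0 := by
  have h1 := Int.mul_ediv_add_emod n q
  have h2 := Int.emod_nonneg n hq.ne'
  have h3 := Int.emod_lt_of_pos n hq
  split_ifs with h
  · obtain ⟨m, hm⟩ := h
    have hd : n / q = m - 1 := by
      rw [Int.ediv_eq_iff_of_pos hq]
      constructor <;> nlinarith
    rw [hm, Int.mul_ediv_cancel_left _ hq.ne', hd]
    ring
  · have hne : n % q + 1 ≠ q := fun he => h ⟨n / q + 1, by linarith⟩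
    have hlt : n % q + 1 < q := by omega
    have hd : (n + 1) / q = n / q := by
      rw [Int.ediv_eq_iff_of_pos hq]
      constructor <;> nlinarith
    rw [hd, sub_self]

/-- A linear congruence with invertible leading coefficient has one solution class. -/
theorem exists_forall_dvd_add_mul_iff_modEq {q p : ℤ} (hq : 0 < q) (hpq : IsCoprime p q) (b : ℤ) :
    ∃ v : ℕ, ∀ k : ℕ, q ∣ b + p * k ↔ k ≡ v [MOD q.toNat] := by
  obtain ⟨u, w, huw⟩ := hpq
  refine ⟨((-b * u) % q).toNat, fun k => ?_⟩
  rw [← Int.natCast_modEq_iff, Int.toNat_of_nonneg hq.le,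
    Int.toNat_of_nonneg (Int.emod_nonneg _ hq.ne')]
  have hmod : (-b * u) % q ≡ -b * u [ZMOD q] := Int.mod_modEq _ _
  have hiff : (k : ℤ) ≡ (-b * u) % q [ZMOD q] ↔ (k : ℤ) ≡ -b * u [ZMOD q] :=
    ⟨fun h => h.trans hmod, fun h => h.trans hmod.symm⟩
  rw [hiff, Int.modEq_comm, Int.modEq_iff_dvd]
  constructor
  · rintro ⟨m, hm⟩
    exact ⟨u * m + w * k, by linear_combination u * hm - (k : ℤ) * huw⟩
  · rintro ⟨m, hm⟩
    exact ⟨p * m + w * b, by linear_combination p * hm - b * huw⟩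

theorem sum_Ioc_ediv_succ_sub_ediv {q p : ℤ} (hq : 0 < q) (hpq : IsCoprime p q) (i : ℤ) (n : ℕ) :
    ∑ k ∈ Finset.Ioc 0 (n * q.toNat), ((i + 1 + p * k) / q - (i + p * k) / q) = n := by
  obtain ⟨v, hv⟩ := exists_forall_dvd_add_mul_iff_modEq hq hpq (i + 1)
  have hstep (k : ℕ) : (i + 1 + p * k) / q - (i + p * k) / q =
      if k ≡ v [MOD q.toNat] then 1 else 0 := by
    simp only [← hv k, add_right_comm i 1, succ_ediv_sub_ediv hq]
  have hr : 0 < q.toNat := by omega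
  have hr' : (q.toNat : ℚ) ≠ 0 := by positivity
  simp only [hstep, Finset.sum_boole]
  rw [Nat.Ioc_filter_modEq_card _ _ hr]
  push_cast
  rw [sub_div, mul_div_cancel_right₀ _ hr', sub_eq_add_neg (n : ℚ), Int.floor_natCast_add,
    zero_sub, neg_div]
  simp

theorem sum_range_ediv_succ_sub_ediv {q p : ℤ} (hq : 0 < q) (hpq : IsCoprime p q) (i : ℤ) (n : ℕ) :
    ∑ k ∈ Finset.range (n * q.toNat), ((i + 1 + p * k) / q - (i + p * k) / q) = n := by
  rw [← sum_Ioc_ediv_succ_sub_ediv hq hpq (i - p) n, ← Finset.Ico_add_one_add_one_eq_Ioc,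
    ← Finset.sum_Ico_add', Finset.range_eq_Ico]
  refine Finset.sum_congr rfl fun k _ => ?_
  push_cast
  ring_nf

/-- Lemma 3.10: if `0 ≤ i < p`, `p, q` coprime positive, and `⌊i/q⌋ = ⌊(i+1)/q⌋`,
then `D_{i+1,tq} - D_{i,tq} = 2t` for all integers `t`. -/
theorem difference_calc (p q i : ℤ) (hp : 0 < p) (hq : 0 < q) (hpq : IsCoprime p q)
    (hi0 : 0 ≤ i) (hip : i < p)
    (hfloor : ⌊(i : ℚ) / (q : ℚ)⌋ = ⌊((i : ℚ) + 1) / (q : ℚ)⌋) :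
    ∀ t : ℤ, mappingConeD p q (i + 1) (t * q) - mappingConeD p q i (t * q) = 2 * t := by
  intro t
  rcases lt_trichotomy t 0 with ht | rfl | ht
  · have hs : t * q < 0 := mul_neg_of_neg_of_pos ht hq
    have hn : (-(t * q)).toNat = t.natAbs * q.toNat := by
      zify
      rw [Int.toNat_of_nonneg (by omega), Int.toNat_of_nonneg hq.le, abs_of_neg ht]
      ring
    have key : ∑ k ∈ Finset.Ioc 0 (t.natAbs * q.toNat),
        ((i + 1 + -p * k) / q - (i + -p * k) / q) = t.natAbs :=
      sum_Ioc_ediv_succ_sub_ediv hq hpq.neg_left i t.natAbs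
    simp only [mappingConeD, if_neg hs.not_gt, if_neg hs.ne, hn]
    have hceil : ∀ (j : ℤ) (k : ℕ),
        ⌈((k : ℚ) * (p : ℚ) - (j : ℚ)) / (q : ℚ)⌉ = -((j + -p * k) / q) := by
      intro j k
      rw [← floor_intCast_div_intCast hq.le, ← Int.ceil_neg]
      push_cast
      ring_nf
    simp only [hceil, ← Finset.mul_sum, ← mul_sub, ← Finset.sum_sub_distrib]
    simp only [Finset.sum_sub_distrib, Finset.sum_neg_distrib] at key ⊢
    change 2 * (-∑ k ∈ Finset.Ioc 0 (t.natAbs * q.toNat), _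
      - -∑ k ∈ Finset.Ioc 0 (t.natAbs * q.toNat), _) = _
    omega
  · simp [mappingConeD]
  · have hs : 0 < t * q := mul_pos ht hq
    have hn : (t * q).toNat = t.natAbs * q.toNat := by
      zify
      rw [Int.toNat_of_nonneg hs.le, Int.toNat_of_nonneg hq.le, abs_of_pos ht]
    have key := sum_range_ediv_succ_sub_ediv hq hpq i t.natAbs
    simp only [mappingConeD, if_pos hs, hn]
    have hfl : ∀ (j : ℤ) (k : ℕ),
        ⌊((j : ℚ) + (p : ℚ) * (k : ℚ)) / (q : ℚ)⌋ = (j + p * k) / q := by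
      intro j k
      rw [← floor_intCast_div_intCast hq.le]
      push_cast
      rfl
    simp only [hfl, ← Finset.mul_sum, ← mul_sub, ← Finset.sum_sub_distrib, key]
    omega
end

section
/- Let F = ℤ/2ℤ and let M be an F[U]-module admitting a direct sum decomposition M = M' ⊕ T of F[U]-modules, where T is isomorphic as an F[U]-module to (F[U]/(U))ⁿ for some natural number n, and where M' contains no element x with U·x = 0 and x ∉ U·M'. Then the F-vector space K/(K ∩ U·M), where K = {x ∈ M : U·x = 0}, has dimension n over F. -/
open Polynomial

/-- The kernel of multiplication by `r`, modulo its multiples of `r`, is isomorphic to the summand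
`T` killed by `r`, when every `r`-torsion element of the complementary summand is a multiple
of `r`. -/
theorem nonempty_linearEquiv_ker_lsmul_quotient {R M : Type*} [CommRing R] [AddCommGroup M]
    [Module R M] (r : R) {N T : Submodule R M} (h : IsCompl N T) (hT : ∀ t : T, r • t = 0)
    (hN : ∀ x : N, r • x = 0 → ∃ y : N, x = r • y) :
    Nonempty ((LinearMap.ker (LinearMap.lsmul R M r) ⧸
      Submodule.comap (LinearMap.ker (LinearMap.lsmul R M r)).subtype
        (LinearMap.ker (LinearMap.lsmul R M r) ⊓ LinearMap.range (LinearMap.lsmul R M r)))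
      ≃ₗ[R] T) := by
  let p : M →ₗ[R] T := T.projectionOnto N h.symm
  let f : LinearMap.ker (LinearMap.lsmul R M r) →ₗ[R] T := p ∘ₗ Submodule.subtype _
  have hf : Function.Surjective f := fun t ↦
    ⟨⟨t, by simpa using congrArg Subtype.val (hT t)⟩,
      Submodule.projectionOnto_apply_left h.symm t⟩
  have hker : Submodule.comap (LinearMap.ker (LinearMap.lsmul R M r)).subtype
      (LinearMap.ker (LinearMap.lsmul R M r) ⊓ LinearMap.range (LinearMap.lsmul R M r)) =
      LinearMap.ker f := by
    ext ⟨x, hx⟩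
    have hx' : r • x = 0 := by simpa using hx
    constructor
    · rintro ⟨-, y, rfl⟩
      change p (r • y) = 0
      rw [map_smul, hT]
    · intro hxf
      have hxN : x ∈ N := (Submodule.projectionOnto_apply_eq_zero_iff h.symm).1 hxf
      obtain ⟨y, hy⟩ := hN ⟨x, hxN⟩ (Subtype.ext hx')
      exact ⟨hx, y, (congrArg Subtype.val hy).symm⟩
  exact ⟨(Submodule.quotEquivOfEq _ _ hker).trans (f.quotKerEquivOfSurjective hf)⟩

/-- The space `(F[X]/(X))ⁿ` has dimension `n` over `F`. -/
theorem rank_fin_fun_polynomial_quotient_span_X (F : Type*) [Field F] (n : ℕ) :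
    Module.rank F (Fin n → F[X] ⧸ Ideal.span {(X : F[X])}) = n := by
  have e : (F[X] ⧸ Ideal.span {(X : F[X])}) ≃ₗ[F] F :=
    ((Ideal.quotientEquivAlgOfEq F (by simp)).trans
      (quotientSpanXSubCAlgEquiv (0 : F))).toLinearEquiv
  rw [(LinearEquiv.piCongrRight fun _ : Fin n ↦ e).rank_eq]
  simp

/-- If an `𝔽[U]`-module `M` (with `𝔽 = ℤ/2ℤ`) decomposes as `M = M' ⊕ T` with
`T ≅ (𝔽[U]/(U))ⁿ` and `M'` containing no element `x` with `U·x = 0` and `x ∉ U·M'`,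
then the `𝔽`-vector space `K/(K ∩ U·M)`, where `K = {x ∈ M : U·x = 0}`, has dimension `n`. -/
theorem dim_F_factor_quotient (M : Type*) [AddCommGroup M] [Module ((ZMod 2)[X]) M]
    (n : ℕ) (M' T : Submodule ((ZMod 2)[X]) M) (hcompl : IsCompl M' T)
    (hT : Nonempty (T ≃ₗ[(ZMod 2)[X]]
      (Fin n → ((ZMod 2)[X] ⧸ (Ideal.span {(X : (ZMod 2)[X])})))))
    (hM' : ∀ x : M', (X : (ZMod 2)[X]) • x = 0 → ∃ y : M', x = (X : (ZMod 2)[X]) • y) :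
    Module.rank (ZMod 2)
      (RestrictScalars (ZMod 2) ((ZMod 2)[X])
        ((LinearMap.ker (LinearMap.lsmul ((ZMod 2)[X]) M (X : (ZMod 2)[X]))) ⧸
          (Submodule.comap
            (LinearMap.ker (LinearMap.lsmul ((ZMod 2)[X]) M (X : (ZMod 2)[X]))).subtype
            (LinearMap.ker (LinearMap.lsmul ((ZMod 2)[X]) M (X : (ZMod 2)[X])) ⊓
              LinearMap.range (LinearMap.lsmul ((ZMod 2)[X]) M (X : (ZMod 2)[X])))))) =
      n := by
  obtain ⟨e⟩ := hT
  have hXT : ∀ t : T, (X : (ZMod 2)[X]) • t = 0 := fun t ↦ by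
    apply e.injective
    rw [map_smul, map_zero]
    ext i
    obtain ⟨q, hq⟩ := Ideal.Quotient.mk_surjective (e t i)
    rw [Pi.smul_apply, ← hq, Pi.zero_apply]
    change Ideal.Quotient.mk _ (X * q) = 0
    rw [Ideal.Quotient.eq_zero_iff_mem]
    exact Ideal.mul_mem_right _ _ (Ideal.mem_span_singleton_self _)
  obtain ⟨g⟩ := nonempty_linearEquiv_ker_lsmul_quotient X hcompl hXT hM'
  let k := (RestrictScalars.addEquiv (ZMod 2) (ZMod 2)[X] _).trans (g.trans e).toAddEquiv
  let l := k.toLinearEquiv fun (c : ZMod 2) x ↦ by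
    change (g.trans e) (RestrictScalars.addEquiv _ _ _ (c • x)) = _
    rw [RestrictScalars.addEquiv_map_smul, map_smul, algebraMap_smul]
    rfl
  have hl := l.lift_rank_eq
  rw [rank_fin_fun_polynomial_quotient_span_X, Cardinal.lift_natCast] at hl
  exact Cardinal.lift_eq_nat_iff.1 hl
end
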